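/- For all integers r ≥ 2 and n ≥ k+1, the maximum number of r-cliques in an n-vertex graph that is 𝓛_k-free equals max{ h_r(n,k,0), h_r(n,k,⌊(k-1)/2⌋) }. -/

import Mathlib

open SimpleGraph

/-- The degree of a vertex `v` in a graph `G` (as the cardinality of its neighbor set). -/
noncomputable def degN {V : Type*} (G : SimpleGraph V) (v : V) : ℕ :=
  (G.neighborSet v).ncard

/-- A linear forest: an acyclic graph all of whose vertices have degree at most `2`,
i.e. a forest whose connected components are paths and isolated vertices. -/
def IsLinearForest {V : Type*} (H : SimpleGraph V) : Prop :=
  H.IsAcyclic ∧ ∀ v, degN H v ≤ 2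

/-- `G` is `𝓛ₖ`-free: it contains no linear forest with exactly `k` edges as a subgraph. -/
def LinearForestFree {V : Type*} (k : ℕ) (G : SimpleGraph V) : Prop :=
  ∀ H : SimpleGraph V, H ≤ G → IsLinearForest H → H.edgeSet.ncard ≠ k

/-- `Nr r G` is the number of `r`-cliques of `G`. -/
noncomputable def Nr {V : Type*} (r : ℕ) (G : SimpleGraph V) : ℕ :=
  {s : Finset V | G.IsNClique r s}.ncard

/-- `hr r n k a = C(k-a, r) + (n-k+a) * C(a, r-1)` (as an integer). -/
def hr (r n k a : ℕ) : ℤ :=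
  (Nat.choose (k - a) r : ℤ) + ((n : ℤ) - (k : ℤ) + (a : ℤ)) * (Nat.choose a (r - 1) : ℤ)

/-- The graph `H(n,k,a)`: vertices `0,…,a-1` form the set `A`, vertices `a,…,k-a-1` form
the set `B`, the remaining `n-k+a` vertices form the set `C`; the edges are all edges inside
`A ∪ B` together with all edges between `A` and `C`. -/
def HGraph (n k a : ℕ) : SimpleGraph (Fin n) :=
  SimpleGraph.fromRel (fun u v => (u : ℕ) < a ∨ ((u : ℕ) < k - a ∧ (v : ℕ) < k - a))

/-- `H⁺(n,k,a)`: the graph `H(n,k,a)` with one extra edge inside `C`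
(between the first two vertices of `C`). -/
def HplusGraph (n k a : ℕ) : SimpleGraph (Fin n) :=
  SimpleGraph.fromRel (fun u v => (u : ℕ) < a ∨ ((u : ℕ) < k - a ∧ (v : ℕ) < k - a)
    ∨ ((u : ℕ) = k - a ∧ (v : ℕ) = k - a + 1))

/-- `H⁺⁺(n,k,a)`: the graph `H(n,k,a)` with two extra independent edges inside `C`. -/
def HplusplusGraph (n k a : ℕ) : SimpleGraph (Fin n) :=
  SimpleGraph.fromRel (fun u v => (u : ℕ) < a ∨ ((u : ℕ) < k - a ∧ (v : ℕ) < k - a)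
    ∨ ((u : ℕ) = k - a ∧ (v : ℕ) = k - a + 1)
    ∨ ((u : ℕ) = k - a + 2 ∧ (v : ℕ) = k - a + 3))

/-- `G` is isomorphic to a subgraph of `H`. -/
def IsoSubgraph {V W : Type*} (G : SimpleGraph V) (H : SimpleGraph W) : Prop :=
  ∃ f : V ↪ W, ∀ u v, G.Adj u v → H.Adj (f u) (f v)

/-- The sum of `f` over the pairs of consecutive entries of a list. -/
def pairSum {V : Type*} (f : V → V → ℕ) : List V → ℕ
  | [] => 0
  | [_] => 0
  | a :: b :: l => f a b + pairSum f (b :: l)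

section PairSum

variable {V : Type*} {f g : V → V → ℕ}

lemma pairSum_append_cons_cons (l₁ : List V) (a b : V) (l₂ : List V) :
    pairSum f (l₁ ++ a :: b :: l₂) = pairSum f (l₁ ++ [a]) + f a b + pairSum f (b :: l₂) := by
  induction l₁ with
  | nil => simp [pairSum]
  | cons c l ih =>
    cases l with
    | nil => simp [pairSum, Nat.add_assoc]
    | cons d l =>
      simp only [List.cons_append, pairSum] at ih ⊢
      omega

lemma pairSum_reverse (hf : ∀ x y, f x y = f y x) (l : List V) :
    pairSum f l.reverse = pairSum f l := by
  induction l with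
  | nil => rfl
  | cons a l ih =>
    cases l with
    | nil => rfl
    | cons b l =>
      have h := pairSum_append_cons_cons (f := f) l.reverse b a []
      simp only [List.reverse_cons, List.append_assoc, List.cons_append, List.nil_append] at ih ⊢ h
      rw [h, ih]
      simp only [pairSum]
      rw [hf b a]
      omega

lemma pairSum_le_append (l₁ l₂ : List V) : pairSum f l₁ ≤ pairSum f (l₁ ++ l₂) := by
  induction l₁ with
  | nil => simp [pairSum]
  | cons a l ih =>
    cases l with
    | nil => simp [pairSum]
    | cons b l =>
      simp only [List.cons_append, pairSum] at ih ⊢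
      omega

lemma pairSum_congr {l : List V} (h : ∀ x ∈ l, ∀ y ∈ l, f x y = g x y) :
    pairSum f l = pairSum g l := by
  induction l with
  | nil => rfl
  | cons a l ih =>
    cases l with
    | nil => rfl
    | cons b l =>
      simp only [pairSum]
      rw [h a (by simp) b (by simp), ih fun x hx y hy => h x (by simp [hx]) y (by simp [hy])]

lemma pairSum_le_pairSum {l : List V}
    (h : ∀ l₁ x y l₂, l = l₁ ++ x :: y :: l₂ → g x y ≤ f x y) :
    pairSum g l ≤ pairSum f l := by
  induction l with
  | nil => simp [pairSum]
  | cons a l ih =>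
    cases l with
    | nil => simp [pairSum]
    | cons b l =>
      have h₁ := h [] a b l rfl
      have h₂ := ih fun l₁ x y l₂ e => h (a :: l₁) x y l₂ (by simp [e])
      simp only [pairSum]
      omega

lemma exists_eq_zero_of_pairSum_add_one_lt {l : List V} (h : pairSum f l + 1 < l.length) :
    ∃ l₁ x y l₂, l = l₁ ++ x :: y :: l₂ ∧ f x y = 0 := by
  by_contra! hne
  have key : pairSum (fun _ _ => 1) l ≤ pairSum f l :=
    pairSum_le_pairSum fun l₁ x y l₂ e => Nat.one_le_iff_ne_zero.2 (hne l₁ x y l₂ e)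
  have hlen : ∀ l : List V, pairSum (fun _ _ => 1) l + 1 ≥ l.length := by
    intro l
    induction l with
    | nil => simp
    | cons a l ih =>
      cases l with
      | nil => simp
      | cons b l =>
        simp only [pairSum, List.length_cons] at ih ⊢
        omega
  have := hlen l
  omega

lemma pairSum_add_eq (p q : V → ℕ) (a : V) (l : List V) (z : V) :
    pairSum (fun x y => p y + q x) (a :: l ++ [z]) + p a + q z =
      ((a :: l ++ [z]).map p).sum + ((a :: l ++ [z]).map q).sum := by
  induction l generalizing a with
  | nil => simp [pairSum]; omega
  | cons b l ih =>
    have := ih b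
    simp only [List.cons_append, pairSum, List.map_cons, List.sum_cons] at this ⊢
    omega

end PairSum

open scoped Classical in
/-- The indicator function of adjacency. -/
noncomputable def adjInd {V : Type*} (G : SimpleGraph V) (x y : V) : ℕ :=
  if G.Adj x y then 1 else 0

section Lists

variable {V : Type*} {G : SimpleGraph V}

lemma adjInd_comm (x y : V) : adjInd G x y = adjInd G y x := by
  by_cases h : G.Adj x y
  · simp [adjInd, h, h.symm]
  · simp [adjInd, h, mt Adj.symm h]

lemma adjInd_of_adj {x y : V} (h : G.Adj x y) : adjInd G x y = 1 := by simp [adjInd, h]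

lemma adjInd_of_not_adj {x y : V} (h : ¬ G.Adj x y) : adjInd G x y = 0 := by simp [adjInd, h]

lemma adjInd_le_one (x y : V) : adjInd G x y ≤ 1 := by
  unfold adjInd; split_ifs <;> simp

/-- Every duplicate-free list of vertices has fewer than `k` pairs of adjacent consecutive
entries. -/
def FewConsecutive (k : ℕ) (G : SimpleGraph V) : Prop :=
  ∀ l : List V, l.Nodup → pairSum (adjInd G) l < k

lemma sum_map_adjInd [Fintype V] {l : List V} (hl : l.Nodup) (hm : ∀ x, x ∈ l) (v : V) :
    (l.map (adjInd G v)).sum = degN G v := by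
  classical
  have : l.toFinset = Finset.univ := by ext; simp [hm]
  rw [← List.sum_toFinset _ hl, this]
  unfold adjInd degN
  rw [Finset.sum_boole, Set.ncard_eq_toFinset_card', Nat.cast_id]
  congr 1
  ext; simp

/-- If the two ends of a list of all vertices are adjacent, then counting this pair as well still
gives fewer than `k` adjacent pairs, since the cyclic order may be cut at a nonadjacent pair. -/
lemma FewConsecutive.pairSum_add_one_lt [Fintype V] {k : ℕ} (hG : FewConsecutive k G)
    (hn : k + 1 ≤ Fintype.card V) {x u : V} {l s t : List V} (hl : l.Nodup) (hm : ∀ x, x ∈ l)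
    (hs : l = x :: s) (ht : l = t ++ [u]) (hux : G.Adj u x) :
    pairSum (adjInd G) l + 1 < k := by
  classical
  have hlen : l.length = Fintype.card V := by
    rw [← List.toFinset_card_of_nodup hl, ← Finset.card_univ]
    congr 1
    ext; simp [hm]
  by_contra! hk
  have hlt := hG l hl
  obtain ⟨l₁, p, q, l₂, e, hpq⟩ :=
    exists_eq_zero_of_pairSum_add_one_lt (f := adjInd G) (l := l) (by omega)
  have hsum := pairSum_append_cons_cons (f := adjInd G) l₁ p q l₂
  rw [← e] at hsum
  obtain ⟨a, ha⟩ : ∃ a, l₁ ++ [p] = x :: a := by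
    cases l₁ with
    | nil => simp_all
    | cons c l₁ => exact ⟨l₁ ++ [p], by simp_all⟩
  obtain ⟨b, hb⟩ : ∃ b, q :: l₂ = b ++ [u] := by
    rcases List.eq_nil_or_concat (q :: l₂) with h | ⟨b, c, h⟩
    · simp at h
    · refine ⟨b, ?_⟩
      have h' : l₁ ++ [p] ++ b ++ [c] = t ++ [u] := by
        rw [← ht, e, List.append_assoc, ← List.concat_eq_append (as := b), ← h]; simp
      have := (List.append_inj' h' rfl).2
      simp_all
  have hnew := hG (b ++ u :: x :: a) (by
    have : (l₁ ++ [p] ++ q :: l₂).Nodup := by simpa [e] using hl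
    rw [List.nodup_append_comm, hb, ha] at this
    simpa using this)
  rw [pairSum_append_cons_cons, ← hb, ← ha, adjInd_of_adj hux] at hnew
  omega

lemma FewConsecutive.adjInd_add_le [Fintype V] {k : ℕ} (hG : FewConsecutive k G)
    (hn : k + 1 ≤ Fintype.card V) {u v x y : V} {M l₁ l₂ : List V}
    (hl : (v :: M ++ [u]).Nodup) (hm : ∀ x, x ∈ v :: M ++ [u])
    (hk : k ≤ pairSum (adjInd G) (v :: M ++ [u]) + 1)
    (e : v :: M ++ [u] = l₁ ++ x :: y :: l₂) :
    adjInd G v y + adjInd G u x ≤ adjInd G x y := by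
  have hsum := pairSum_append_cons_cons (f := adjInd G) l₁ x y l₂
  rw [← e] at hsum
  have hlt := hG _ hl
  obtain ⟨t, ht⟩ : ∃ t, l₁ ++ [x] = v :: t := by
    cases l₁ with
    | nil => simp_all
    | cons c l₁ => exact ⟨l₁ ++ [x], by simp_all⟩
  obtain ⟨s, hs⟩ : ∃ s, y :: l₂ = s ++ [u] := by
    rcases List.eq_nil_or_concat (y :: l₂) with h | ⟨b, c, h⟩
    · simp at h
    · refine ⟨b, ?_⟩
      have h' : l₁ ++ [x] ++ b ++ [c] = v :: M ++ [u] := by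
        rw [e, List.append_assoc, ← List.concat_eq_append (as := b), ← h]; simp
      have := (List.append_inj' h' rfl).2
      simp_all
  have e' : v :: M ++ [u] = v :: t ++ (s ++ [u]) := by rw [e, ← ht, ← hs]; simp
  have hp₁ : (t.reverse ++ v :: y :: l₂).Perm (v :: M ++ [u]) := by
    rw [e', ← hs]
    have : t.reverse ++ v :: y :: l₂ = (v :: t).reverse ++ y :: l₂ := by simp
    rw [this]
    exact (List.reverse_perm _).append_right _
  have hp₂ : (l₁ ++ x :: u :: s.reverse).Perm (v :: M ++ [u]) := by
    rw [e', ← ht]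
    have : l₁ ++ x :: u :: s.reverse = l₁ ++ [x] ++ (s ++ [u]).reverse := by simp
    rw [this]
    exact (List.reverse_perm _).append_left _
  have h₁ := hG _ (hp₁.nodup_iff.2 hl)
  have h₂ := hG _ (hp₂.nodup_iff.2 hl)
  have r₁ : pairSum (adjInd G) (t.reverse ++ [v]) = pairSum (adjInd G) (l₁ ++ [x]) := by
    rw [ht, ← pairSum_reverse adjInd_comm (v :: t)]; simp
  have r₂ : pairSum (adjInd G) (u :: s.reverse) = pairSum (adjInd G) (y :: l₂) := by
    rw [hs, ← pairSum_reverse adjInd_comm (s ++ [u])]; simp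
  have c₁ := pairSum_append_cons_cons (f := adjInd G) t.reverse v y l₂
  rw [pairSum_append_cons_cons] at h₂
  rw [c₁] at h₁
  rw [r₁] at h₁ c₁
  rw [r₂] at h₂
  rw [adjInd_comm u x]
  rw [adjInd_comm x u] at h₂ ⊢
  by_cases hxy : G.Adj x y
  · rw [adjInd_of_adj hxy] at hsum ⊢
    by_contra! hgt
    have b₁ := adjInd_le_one (G := G) v y
    have b₂ := adjInd_le_one (G := G) u x
    have hux : G.Adj u x := by
      by_contra h
      rw [adjInd_of_not_adj h] at hgt
      omega
    have := hG.pairSum_add_one_lt hn (x := x) (u := u) (s := l₁.reverse ++ y :: l₂)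
      (t := t.reverse ++ v :: s) (hp₁.nodup_iff.2 hl) (fun z => hp₁.mem_iff.2 (hm z))
      (by
        have : t.reverse ++ [v] = x :: l₁.reverse := by
          rw [← List.reverse_cons, ← ht]; simp
        rw [← List.cons_append, ← this]; simp)
      (by rw [hs]; simp) hux
    omega
  · rw [adjInd_of_not_adj hxy] at hsum ⊢
    omega

lemma pairSum_sup_edge {u v : V} (l : List V)
    (h : pairSum (adjInd G) l < pairSum (adjInd (G ⊔ edge u v)) l) :
    ∃ l₁ x y l₂, l = l₁ ++ x :: y :: l₂ ∧ (x = u ∧ y = v ∨ x = v ∧ y = u) := by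
  by_contra! hne
  refine h.not_ge (pairSum_le_pairSum fun l₁ x y l₂ e => ?_)
  have := hne l₁ x y l₂ e
  unfold adjInd
  by_cases hG : G.Adj x y
  · simp [hG]
  · rw [if_neg (by rw [sup_adj, edge_adj]; tauto)]
    simp

/-- The Bondy–Chvátal closure inequality for linear forests. -/
lemma FewConsecutive.degN_add_degN_lt [Fintype V] {k : ℕ} (hG : FewConsecutive k G)
    (hn : k + 1 ≤ Fintype.card V) {u v : V} (huv : u ≠ v)
    (hsup : ¬ FewConsecutive k (G ⊔ edge u v)) : degN G u + degN G v < k := by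
  classical
  simp only [FewConsecutive, not_forall, not_lt] at hsup
  obtain ⟨l₀, hl₀, hk₀⟩ := hsup
  obtain ⟨l, hl, hm, hk⟩ : ∃ l : List V, l.Nodup ∧ (∀ x, x ∈ l) ∧
      k ≤ pairSum (adjInd (G ⊔ edge u v)) l := by
    refine ⟨l₀ ++ (Finset.univ \ l₀.toFinset).toList, ?_, ?_, hk₀.trans (pairSum_le_append _ _)⟩
    · refine hl₀.append (Finset.nodup_toList _) ?_
      intro x hx
      simp [hx]
    · intro x
      simp only [List.mem_append, Finset.mem_toList, Finset.mem_sdiff, Finset.mem_univ, true_and,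
        List.mem_toFinset]
      tauto
  clear hk₀ hl₀ l₀
  obtain ⟨l₁, l₂, hl, hm, hk⟩ : ∃ l₁ l₂ : List V, (l₁ ++ u :: v :: l₂).Nodup ∧
      (∀ x, x ∈ l₁ ++ u :: v :: l₂) ∧
      k ≤ pairSum (adjInd (G ⊔ edge u v)) (l₁ ++ u :: v :: l₂) := by
    obtain ⟨l₁, x, y, l₂, rfl, ⟨rfl, rfl⟩ | ⟨rfl, rfl⟩⟩ :=
      pairSum_sup_edge (G := G) (u := u) (v := v) l ((hG l hl).trans_le hk)
    · exact ⟨l₁, l₂, hl, hm, hk⟩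
    · have e : l₂.reverse ++ y :: x :: l₁.reverse = (l₁ ++ x :: y :: l₂).reverse := by simp
      refine ⟨l₂.reverse, l₁.reverse, ?_, ?_, ?_⟩
      · rw [e]; exact List.nodup_reverse.2 hl
      · intro z; rw [e]; exact List.mem_reverse.2 (hm z)
      · rw [e, pairSum_reverse adjInd_comm]; exact hk
  have hperm : (v :: (l₂ ++ l₁) ++ [u]).Perm (l₁ ++ u :: v :: l₂) := by
    have e₁ : v :: (l₂ ++ l₁) ++ [u] = v :: l₂ ++ (l₁ ++ [u]) := by simp
    have e₂ : l₁ ++ u :: v :: l₂ = (l₁ ++ [u]) ++ v :: l₂ := by simp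
    rw [e₁, e₂]
    exact List.perm_append_comm
  have hl' := hperm.nodup_iff.2 hl
  have hm' : ∀ x, x ∈ v :: (l₂ ++ l₁) ++ [u] := fun z => hperm.mem_iff.2 (hm z)
  have hnot : ∀ l : List V, (u ∉ l ∨ v ∉ l) →
      pairSum (adjInd (G ⊔ edge u v)) l = pairSum (adjInd G) l := by
    intro l h
    refine pairSum_congr fun x hx y hy => ?_
    have : ¬ (edge u v).Adj x y := by
      rw [edge_adj]
      rintro ⟨⟨rfl, rfl⟩ | ⟨rfl, rfl⟩, -⟩ <;> tauto
    simp [adjInd, this]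
  rw [pairSum_append_cons_cons, hnot _ (Or.inr ?_), hnot _ (Or.inl ?_)] at hk
  rotate_left
  · intro h
    have := (List.nodup_append.1 hl).2.1
    simp at this h
    tauto
  · intro h
    simp only [List.mem_append, List.mem_singleton] at h
    rcases h with h | h
    · exact (List.nodup_append.1 hl).2.2 v h v (by simp) rfl
    · exact huv h.symm
  have hk' : k ≤ pairSum (adjInd G) (v :: (l₂ ++ l₁) ++ [u]) + 1 := by
    have hge : pairSum (adjInd G) (v :: l₂) + pairSum (adjInd G) (l₁ ++ [u]) ≤
        pairSum (adjInd G) (v :: l₂ ++ (l₁ ++ [u])) := by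
      rcases List.eq_nil_or_concat (v :: l₂) with h | ⟨b, c, h⟩
      · simp at h
      · rw [h, List.concat_eq_append]
        cases h' : l₁ ++ [u] with
        | nil => simp at h'
        | cons d m =>
          have := pairSum_append_cons_cons (f := adjInd G) b c d m
          simp only [List.append_assoc, List.cons_append, List.nil_append]
          omega
    have := adjInd_le_one (G := G ⊔ edge u v) u v
    have e₁ : v :: (l₂ ++ l₁) ++ [u] = v :: l₂ ++ (l₁ ++ [u]) := by simp
    rw [e₁]
    omega
  have hle := pairSum_le_pairSum (l := v :: (l₂ ++ l₁) ++ [u])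
    (g := fun x y => adjInd G v y + adjInd G u x) (f := adjInd G)
    fun a x y b e => hG.adjInd_add_le hn hl' hm' hk' e
  have hsum := pairSum_add_eq (adjInd G v) (adjInd G u) v (l₂ ++ l₁) u
  rw [sum_map_adjInd hl' hm', sum_map_adjInd hl' hm', adjInd_of_not_adj (G.irrefl),
    adjInd_of_not_adj (G.irrefl)] at hsum
  have := hG _ hl'
  omega

/-- A Pósa-type degree condition. -/
lemma FewConsecutive.exists_low_degree [Fintype V] {k : ℕ} (hG : FewConsecutive k G)
    (hn : k + 1 ≤ Fintype.card V) :
    ∃ s : ℕ, 2 * s + 1 ≤ k ∧ ∃ L : Finset V, L.card = Fintype.card V - k + s ∧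
      ∀ v ∈ L, degN G v ≤ s := by
  classical
  obtain ⟨G', hle, hmax⟩ := Finite.exists_le_maximal (p := FewConsecutive k) hG
  have hG' := hmax.prop
  have hdeg : ∀ v, degN G v ≤ degN G' v := fun v =>
    Set.ncard_le_ncard (fun w hw => hle hw) (Set.toFinite _)
  let S : Finset (V × V) := Finset.univ.filter fun p => p.1 ≠ p.2 ∧ ¬ G'.Adj p.1 p.2
  have hS : S.Nonempty := by
    have h := hG' _ (Finset.nodup_toList Finset.univ)
    obtain ⟨l₁, x, y, l₂, e, hxy⟩ := exists_eq_zero_of_pairSum_add_one_lt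
      (f := adjInd G') (l := (Finset.univ : Finset V).toList) (by
        rw [Finset.length_toList, Finset.card_univ]; omega)
    refine ⟨(x, y), ?_⟩
    have hnd := Finset.nodup_toList (Finset.univ : Finset V)
    rw [e] at hnd
    have := (List.nodup_append.1 hnd).2.1
    simp only [Finset.mem_filter, Finset.mem_univ, true_and, S]
    refine ⟨fun h => by simp [h] at this, fun h => ?_⟩
    rw [adjInd_of_adj h] at hxy
    simp at hxy
  obtain ⟨⟨u, v⟩, hp, hpmax⟩ := S.exists_max_image (fun p => degN G' p.1 + degN G' p.2) hS
  have hp' : u ≠ v ∧ ¬ G'.Adj u v := by simpa [S] using hp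
  have hlt : ∀ a b, a ≠ b → ¬ G'.Adj a b → degN G' a + degN G' b < k := by
    intro a b hab hadj
    refine hG'.degN_add_degN_lt hn hab fun h => ?_
    have := hmax.le_of_ge h le_sup_left
    exact hadj (this (Or.inr (by simp [edge_adj, hab])))
  have main : ∀ u v, u ≠ v → ¬ G'.Adj u v → degN G' u ≤ degN G' v →
      (∀ w, w ≠ v → ¬ G'.Adj w v → degN G' w ≤ degN G' u) →
      ∃ s : ℕ, 2 * s + 1 ≤ k ∧ ∃ L : Finset V, L.card = Fintype.card V - k + s ∧
      ∀ v ∈ L, degN G v ≤ s := by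
    intro u v huv hadj hle' hmx
    have hlt' := hlt u v huv hadj
    refine ⟨degN G' u, by omega, ?_⟩
    let N : Finset V := Finset.univ.filter fun w => w ≠ v ∧ ¬ G'.Adj w v
    have hN : N = (insert v (G'.neighborSet v).toFinset)ᶜ := by
      ext w
      simp only [N, Finset.mem_filter, Finset.mem_univ, true_and, Finset.mem_compl,
        Finset.mem_insert, Set.mem_toFinset, mem_neighborSet, G'.adj_comm w v]
      tauto
    have hcard : Fintype.card V - k + degN G' u ≤ N.card := by
      rw [hN, Finset.card_compl, Finset.card_insert_of_notMem (by simp),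
        ← Set.ncard_eq_toFinset_card']
      change _ ≤ Fintype.card V - (degN G' v + 1)
      omega
    obtain ⟨L, hL, hLc⟩ := Finset.exists_subset_card_eq hcard
    refine ⟨L, hLc, fun w hw => (hdeg w).trans ?_⟩
    have := hL hw
    simp only [N, Finset.mem_filter, Finset.mem_univ, true_and] at this
    exact hmx w this.1 this.2
  have hmx : ∀ a b, a ≠ b → ¬ G'.Adj a b → degN G' a + degN G' b ≤ degN G' u + degN G' v :=
    fun a b h₁ h₂ => hpmax (a, b) (by simp [S, h₁, h₂])
  rcases le_total (degN G' u) (degN G' v) with h | h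
  · refine main u v hp'.1 hp'.2 h fun w h₁ h₂ => ?_
    have := hmx w v h₁ h₂
    omega
  · refine main v u hp'.1.symm (fun h => hp'.2 h.symm) h fun w h₁ h₂ => ?_
    have := hmx w u h₁ h₂
    omega

/-- A linear forest can be read off from consecutive entries of a duplicate-free list. -/
lemma exists_isLinearForest_of_le_pairSum [Finite V] (l : List V) (hl : l.Nodup) (j : ℕ)
    (hj : j ≤ pairSum (adjInd G) l) :
    ∃ H ≤ G, IsLinearForest H ∧ H.edgeSet.ncard = j ∧ (∀ x ∉ l, ∀ y, ¬ H.Adj x y) ∧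
      ∀ a m, l = a :: m → degN H a ≤ 1 := by
  induction l generalizing j with
  | nil =>
    obtain rfl : j = 0 := by simpa [pairSum] using hj
    exact ⟨⊥, bot_le, ⟨isAcyclic_bot, by simp [degN, neighborSet]⟩, by simp, by simp, by simp⟩
  | cons a l ih =>
    cases l with
    | nil =>
      obtain rfl : j = 0 := by simpa [pairSum] using hj
      exact ⟨⊥, bot_le, ⟨isAcyclic_bot, by simp [degN, neighborSet]⟩, by simp, by simp,
        by simp [degN, neighborSet]⟩
    | cons b l =>
      have hl' := (List.nodup_cons.1 hl).2
      have ha := (List.nodup_cons.1 hl).1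
      have hab : a ≠ b := by rintro rfl; simp at ha
      by_cases hj' : j ≤ pairSum (adjInd G) (b :: l)
      · obtain ⟨H, hH, hlin, hc, hiso, -⟩ := ih hl' j hj'
        refine ⟨H, hH, hlin, hc, fun x hx => hiso x (by simp at hx ⊢; tauto), ?_⟩
        rintro _ _ ⟨rfl, rfl⟩
        have : H.neighborSet a = ∅ := by
          ext y; simpa using hiso a ha y
        simp [degN, this]
      · have hadj : G.Adj a b := by
          by_contra h
          simp only [pairSum, adjInd_of_not_adj h] at hj
          omega
        simp only [pairSum, adjInd_of_adj hadj] at hj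
        obtain ⟨H, hH, hlin, hc, hiso, hhead⟩ := ih hl' _ le_rfl
        have hb := hhead b l rfl
        have hadjH : ∀ y, ¬ H.Adj a y := hiso a ha
        have hNa : (H ⊔ edge a b).neighborSet a ⊆ {b} := by
          intro y hy
          simp only [mem_neighborSet, sup_adj, edge_adj, hadjH, false_or] at hy
          rcases hy with ⟨⟨-, h⟩ | ⟨h, -⟩, -⟩
          · exact h
          · exact absurd h hab
        have hda : degN (H ⊔ edge a b) a ≤ 1 := by
          simpa [degN] using Set.ncard_le_ncard hNa (Set.toFinite _)
        refine ⟨H ⊔ edge a b, sup_le hH ((edge_le_iff G).2 (Or.inr hadj)), ⟨?_, ?_⟩, ?_, ?_, ?_⟩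
        · refine hlin.1.sup_edge_of_not_reachable ?_
          rintro ⟨w⟩
          cases w with
          | nil => exact hab rfl
          | cons h _ => exact hadjH _ h
        · intro v
          by_cases hva : v = a
          · subst hva; omega
          by_cases hvb : v = b
          · subst hvb
            have : (H ⊔ edge a v).neighborSet v ⊆ insert a (H.neighborSet v) := by
              intro y hy
              simp only [mem_neighborSet, sup_adj, edge_adj] at hy
              simp only [Set.mem_insert_iff, mem_neighborSet]
              tauto
            have h₁ := Set.ncard_le_ncard this (Set.toFinite _)
            have h₂ := Set.ncard_insert_le a (H.neighborSet v)
            unfold degN at hb ⊢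
            omega
          · have : (H ⊔ edge a b).neighborSet v ⊆ H.neighborSet v := by
              intro y hy
              simp only [mem_neighborSet, sup_adj, edge_adj] at hy ⊢
              tauto
            exact (Set.ncard_le_ncard this (Set.toFinite _)).trans (hlin.2 v)
        · rw [edgeSet_sup, edgeSet_edge_of_ne hab, Set.union_singleton,
            Set.ncard_insert_of_notMem (by simpa using hadjH b) (Set.toFinite _), hc]
          omega
        · intro x hx y
          simp only [List.mem_cons, not_or] at hx
          simp only [sup_adj, edge_adj, not_or]
          refine ⟨hiso x (by simp [hx]) y, ?_⟩
          tauto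
        · rintro _ _ ⟨rfl, rfl⟩
          exact hda

lemma LinearForestFree.fewConsecutive [Finite V] {k : ℕ} (hG : LinearForestFree k G) :
    FewConsecutive k G := by
  intro l hl
  by_contra! h
  obtain ⟨H, hle, hlin, hc, -⟩ := exists_isLinearForest_of_le_pairSum l hl k h
  exact hG H hle hlin hc

end Lists

/-- A sequence with nondecreasing increments attains its maximum at an endpoint. -/
lemma le_max_of_monotone_increments {f D : ℕ → ℤ} (hD : Monotone D)
    (hf : ∀ s, f (s + 1) = f s + D s) {s a : ℕ} (hs : s ≤ a) : f s ≤ max (f 0) (f a) := by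
  rcases le_total 0 (D s) with h | h
  · refine le_max_of_le_right ?_
    induction a, hs using Nat.le_induction with
    | base => rfl
    | succ m hm ih =>
      have := hf m
      have := hD hm
      omega
  · refine le_max_of_le_left ?_
    have key : ∀ j ≤ s, f j ≤ f 0 := by
      intro j
      induction j with
      | zero => simp
      | succ j ih =>
        intro hj
        have := ih (by omega)
        have := hf j
        have := hD (show j ≤ s by omega)
        omega
    exact key s le_rfl

lemma hr_le_max {n k r s a : ℕ} (hr2 : 2 ≤ r) (hn : k ≤ n) (hs : s ≤ a) :
    hr r n k s ≤ max (hr r n k 0) (hr r n k a) := by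
  obtain ⟨t, rfl⟩ : ∃ t, r = t + 2 := ⟨r - 2, by omega⟩
  refine le_max_of_monotone_increments (f := hr (t + 2) n k)
    (D := fun s => ((n : ℤ) - k + s) * (Nat.choose s t : ℤ) + (Nat.choose (s + 1) (t + 1) : ℤ)
      - (Nat.choose (k - s - 1) (t + 1) : ℤ)) ?_ ?_ hs
  · intro x y hxy
    have h₁ : (Nat.choose x t : ℤ) ≤ Nat.choose y t := by
      exact_mod_cast Nat.choose_le_choose t hxy
    have h₂ : (Nat.choose (x + 1) (t + 1) : ℤ) ≤ Nat.choose (y + 1) (t + 1) := by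
      exact_mod_cast Nat.choose_le_choose (t + 1) (by omega : x + 1 ≤ y + 1)
    have h₃ : (Nat.choose (k - y - 1) (t + 1) : ℤ) ≤ Nat.choose (k - x - 1) (t + 1) := by
      exact_mod_cast Nat.choose_le_choose (t + 1) (by omega : k - y - 1 ≤ k - x - 1)
    have h₄ : ((n : ℤ) - k + x) * (Nat.choose x t : ℤ) ≤ ((n : ℤ) - k + y) * Nat.choose y t :=
      mul_le_mul (by omega) h₁ (by positivity) (by omega)
    dsimp only
    omega
  · intro s
    have h₁ : (Nat.choose (k - s) (t + 2) : ℤ) =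
        Nat.choose (k - (s + 1)) (t + 2) + Nat.choose (k - s - 1) (t + 1) := by
      rcases Nat.lt_or_ge s k with h | h
      · obtain ⟨m, hm⟩ : ∃ m, k - s = m + 1 := ⟨k - s - 1, by omega⟩
        rw [hm, show k - (s + 1) = m by omega, Nat.choose_succ_succ]
        push_cast
        exact add_comm _ _
      · simp [show k - s = 0 by omega, show k - (s + 1) = 0 by omega]
    have h₂ : (Nat.choose (s + 1) (t + 1) : ℤ) = Nat.choose s t + Nat.choose s (t + 1) := by
      exact_mod_cast Nat.choose_succ_succ s t
    simp only [hr, show t + 2 - 1 = t + 1 by omega]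
    rw [h₁, h₂]
    push_cast
    ring

/-- Counting cliques outside, respectively meeting, a set of low-degree vertices. -/
lemma Nr_le_of_low_degree {V : Type*} [Fintype V] (G : SimpleGraph V) (r s : ℕ)
    (L : Finset V) (hL : ∀ v ∈ L, degN G v ≤ s) :
    Nr r G ≤ (Fintype.card V - L.card).choose r + L.card * s.choose (r - 1) := by
  classical
  have hsub : {S : Finset V | G.IsNClique r S} ⊆
      ↑((Lᶜ).powersetCard r ∪ L.biUnion fun v =>
        (((G.neighborSet v).toFinset).powersetCard (r - 1)).image (insert v)) := by
    intro S hS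
    have hS' : G.IsNClique r S := hS
    simp only [Finset.coe_union, Set.mem_union, Finset.mem_coe]
    by_cases h : S ⊆ Lᶜ
    · exact Or.inl (Finset.mem_powersetCard.2 ⟨h, hS'.card_eq⟩)
    · right
      rw [Finset.not_subset] at h
      obtain ⟨v, hv, hvL⟩ := h
      rw [Finset.mem_biUnion]
      refine ⟨v, by simpa using hvL, Finset.mem_image.2 ⟨S.erase v, ?_, Finset.insert_erase hv⟩⟩
      rw [Finset.mem_powersetCard, Finset.card_erase_of_mem hv, hS'.card_eq]
      refine ⟨fun w hw => ?_, rfl⟩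
      rw [Finset.mem_erase] at hw
      simpa using hS'.isClique hv hw.2 hw.1.symm
  have h := Set.ncard_le_ncard hsub (Finset.finite_toSet _)
  rw [Set.ncard_coe_finset] at h
  refine h.trans ((Finset.card_union_le _ _).trans (Nat.add_le_add ?_ ?_))
  · rw [Finset.card_powersetCard, Finset.card_compl]
  · refine Finset.card_biUnion_le_card_mul _ _ _ fun v hv => Finset.card_image_le.trans ?_
    rw [Finset.card_powersetCard, ← Set.ncard_eq_toFinset_card']
    exact Nat.choose_le_choose _ (hL v hv)

lemma LinearForestFree.Nr_le {n k r : ℕ} (hr2 : 2 ≤ r) (hn : k + 1 ≤ n)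
    {G : SimpleGraph (Fin n)} (hG : LinearForestFree k G) :
    (Nr r G : ℤ) ≤ max (hr r n k 0) (hr r n k ((k - 1) / 2)) := by
  obtain ⟨s, hs, L, hLc, hL⟩ := hG.fewConsecutive.exists_low_degree (by simpa using hn)
  refine le_trans ?_ (hr_le_max (s := s) hr2 (by omega) (by omega))
  have h := Nr_le_of_low_degree G r s L hL
  rw [hLc, Fintype.card_fin, show n - (n - k + s) = k - s by omega] at h
  have hc : ((n - k + s : ℕ) : ℤ) = (n : ℤ) - k + s := by omega
  rw [hr, ← hc]
  exact_mod_cast h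

lemma SimpleGraph.IsAcyclic.ncard_edgeSet_add_one_le {V : Type*} [Finite V] [Nonempty V]
    {H : SimpleGraph V} (hH : H.IsAcyclic) : H.edgeSet.ncard + 1 ≤ Nat.card V := by
  classical
  have := Fintype.ofFinite V
  obtain ⟨T, hHT, -, hT⟩ :=
    (connected_top (V := V)).exists_isTree_le_of_le_of_isAcyclic le_top hH
  have hc := hT.card_edgeFinset
  rw [← Set.ncard_coe_finset, coe_edgeFinset] at hc
  rw [Nat.card_eq_fintype_card, ← hc]
  have := Set.ncard_le_ncard (edgeSet_mono hHT) (Set.toFinite _)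
  omega

/-- The number of edges of a linear forest each of whose edges meets `A` or lies inside `B`. -/
lemma IsLinearForest.ncard_edgeSet_add_one_le {V : Type*} [Finite V] {H : SimpleGraph V}
    (hH : IsLinearForest H) (A B : Finset V) (hB : B.Nonempty)
    (hAB : ∀ x y, H.Adj x y → x ∈ A ∨ y ∈ A ∨ x ∈ B ∧ y ∈ B) :
    H.edgeSet.ncard + 1 ≤ 2 * A.card + B.card := by
  classical
  have := Fintype.ofFinite V
  have : Nonempty (B : Set V) := hB.to_subtype
  have hind := (hH.1.induce (B : Set V)).ncard_edgeSet_add_one_le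
  rw [Nat.card_coe_set_eq, Set.ncard_coe_finset] at hind
  let T : Set (Sym2 V) := Sym2.map Subtype.val '' (H.induce (B : Set V)).edgeSet
  let E : Finset (Sym2 V) := A.biUnion fun v => (H.neighborSet v).toFinset.image fun w => s(v, w)
  have hsub : H.edgeSet ⊆ ↑E ∪ T := by
    intro e he
    induction e with
    | h x y =>
      have hxy : H.Adj x y := he
      simp only [Set.mem_union, Finset.mem_coe, E, Finset.mem_biUnion, Finset.mem_image,
        Set.mem_toFinset, mem_neighborSet]
      rcases hAB x y hxy with h | h | ⟨hx, hy⟩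
      · exact Or.inl ⟨x, h, y, hxy, rfl⟩
      · exact Or.inl ⟨y, h, x, hxy.symm, Sym2.eq_swap⟩
      · exact Or.inr ⟨s(⟨x, hx⟩, ⟨y, hy⟩), hxy, rfl⟩
  have hE : E.card ≤ A.card * 2 := by
    refine Finset.card_biUnion_le_card_mul _ _ _ fun v _ => Finset.card_image_le.trans ?_
    rw [← Set.ncard_eq_toFinset_card']
    exact hH.2 v
  have hT : T.ncard ≤ (H.induce (B : Set V)).edgeSet.ncard := Set.ncard_image_le (Set.toFinite _)
  have h₁ := Set.ncard_le_ncard hsub (Set.toFinite _)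
  have h₂ := Set.ncard_union_le (↑E) T
  rw [Set.ncard_coe_finset] at h₂
  omega

lemma HGraph_adj {n k a : ℕ} {u v : Fin n} :
    (HGraph n k a).Adj u v ↔ u ≠ v ∧
      ((u : ℕ) < a ∨ (v : ℕ) < a ∨ (u : ℕ) < k - a ∧ (v : ℕ) < k - a) := by
  simp only [HGraph, fromRel_adj]
  tauto

lemma linearForestFree_HGraph {n k a : ℕ} (ha : 2 * a + 1 ≤ k) (hn : k ≤ n) :
    LinearForestFree k (HGraph n k a) := by
  intro H hle hlin hcard
  have h := hlin.ncard_edgeSet_add_one_le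
    (Finset.univ.filter fun u : Fin n => (u : ℕ) < a)
    ((Finset.univ.filter fun u : Fin n => (u : ℕ) < k - a) \
      Finset.univ.filter fun u : Fin n => (u : ℕ) < a)
    ⟨⟨a, by omega⟩, by simp; omega⟩ (by
      intro x y hxy
      have := (HGraph_adj.1 (hle hxy)).2
      simp only [Finset.mem_filter, Finset.mem_univ, true_and, Finset.mem_sdiff]
      tauto)
  rw [Finset.card_sdiff_of_subset (by intro x; simp; omega), Fin.card_filter_val_lt,
    Fin.card_filter_val_lt] at h
  omega

lemma hr_le_Nr_HGraph {n k a r : ℕ} (hr1 : 1 ≤ r) (ha : 2 * a ≤ k) (hn : k ≤ n) :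
    hr r n k a ≤ Nr r (HGraph n k a) := by
  classical
  let A : Finset (Fin n) := Finset.univ.filter fun u => (u : ℕ) < a
  let AB : Finset (Fin n) := Finset.univ.filter fun u => (u : ℕ) < k - a
  have hA : A.card = a := by rw [Fin.card_filter_val_lt]; omega
  have hAB : AB.card = k - a := by rw [Fin.card_filter_val_lt]; omega
  have hAsub : A ⊆ AB := by
    intro x hx
    have := (Finset.mem_filter.1 hx).2
    exact Finset.mem_filter.2 ⟨Finset.mem_univ _, by omega⟩
  let P := AB.powersetCard r
  let Q := (ABᶜ ×ˢ A.powersetCard (r - 1)).image fun p => insert p.1 p.2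
  have hQ : Q.card = (n - (k - a)) * a.choose (r - 1) := by
    rw [Finset.card_image_of_injOn, Finset.card_product, Finset.card_compl, hAB,
      Finset.card_powersetCard, hA, Fintype.card_fin]
    rintro ⟨c, S⟩ hc ⟨d, T⟩ hd h
    simp only [Finset.coe_product, Set.mem_prod, Finset.mem_coe, Finset.mem_compl,
      Finset.mem_powersetCard] at hc hd h
    have hcT : c ∉ T := fun h => hc.1 (hAsub (hd.2.1 h))
    have hcS : c ∉ S := fun h => hc.1 (hAsub (hc.2.1 h))
    have hdT : d ∉ T := fun h => hd.1 (hAsub (hd.2.1 h))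
    have hcd : c = d := by
      have : c ∈ insert d T := h ▸ Finset.mem_insert_self c S
      rw [Finset.mem_insert] at this
      tauto
    subst hcd
    have : S = T := by
      rw [← Finset.erase_insert hcS, h, Finset.erase_insert hdT]
    rw [this]
  have hdisj : Disjoint P Q := by
    rw [Finset.disjoint_left]
    intro S hP hQ
    simp only [P, Q, Finset.mem_powersetCard, Finset.mem_image, Finset.mem_product,
      Finset.mem_compl] at hP hQ
    obtain ⟨p, hp, rfl⟩ := hQ
    exact hp.1 (hP.1 (Finset.mem_insert_self _ _))
  have hsub : (↑(P ∪ Q) : Set (Finset (Fin n))) ⊆ {S | (HGraph n k a).IsNClique r S} := by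
    intro S hS
    simp only [Finset.coe_union, Set.mem_union, Finset.mem_coe, P, Q, Finset.mem_powersetCard,
      Finset.mem_image, Finset.mem_product, Finset.mem_compl] at hS
    rcases hS with ⟨h, hc⟩ | ⟨⟨c, T⟩, ⟨hc, hT, hTc⟩, rfl⟩
    · refine ⟨fun x hx y hy hxy => HGraph_adj.2 ⟨hxy, Or.inr (Or.inr ?_)⟩, hc⟩
      have h₁ := h hx
      have h₂ := h hy
      simp only [AB, Finset.mem_filter] at h₁ h₂
      exact ⟨h₁.2, h₂.2⟩
    · have hcT : c ∉ T := fun h => hc (hAsub (hT h))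
      refine ⟨fun x hx y hy hxy => HGraph_adj.2 ⟨hxy, ?_⟩, ?_⟩
      · have hA' : ∀ z ∈ T, (z : ℕ) < a := fun z hz => (Finset.mem_filter.1 (hT hz)).2
        simp only [Finset.coe_insert, Set.mem_insert_iff, Finset.mem_coe] at hx hy
        rcases hx with rfl | hx
        · rcases hy with rfl | hy
          · exact absurd rfl hxy
          · exact Or.inr (Or.inl (hA' y hy))
        · exact Or.inl (hA' x hx)
      · rw [Finset.card_insert_of_notMem hcT]
        dsimp only at hTc
        omega
  have h := Set.ncard_le_ncard hsub (Set.toFinite _)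
  rw [Set.ncard_coe_finset, Finset.card_union_of_disjoint hdisj, hQ, Finset.card_powersetCard,
    hAB] at h
  have hc : ((n - (k - a) : ℕ) : ℤ) = (n : ℤ) - k + a := by omega
  rw [hr, ← hc]
  exact_mod_cast h

/-- Zhang–Wang–Zhou. For `r ≥ 2` and `n ≥ k+1`, the maximum number of
`r`-cliques of an `n`-vertex `𝓛ₖ`-free graph equals `max { hᵣ(n,k,0), hᵣ(n,k,⌊(k-1)/2⌋) }`. -/
theorem statement1 (n k r : ℕ) (hk : 1 ≤ k) (hr2 : 2 ≤ r) (hn : k + 1 ≤ n) :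
    IsGreatest {m : ℤ | ∃ G : SimpleGraph (Fin n),
        LinearForestFree k G ∧ (Nr r G : ℤ) = m}
      (max (hr r n k 0) (hr r n k ((k - 1) / 2))) := by
  refine ⟨?_, ?_⟩
  · have key : ∀ a, 2 * a + 1 ≤ k →
        max (hr r n k 0) (hr r n k ((k - 1) / 2)) = hr r n k a →
        ∃ G : SimpleGraph (Fin n), LinearForestFree k G ∧
          (Nr r G : ℤ) = max (hr r n k 0) (hr r n k ((k - 1) / 2)) := by
      intro a ha hmax
      have hfree : LinearForestFree k (HGraph n k a) := linearForestFree_HGraph ha (by omega)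
      refine ⟨_, hfree, le_antisymm (hfree.Nr_le hr2 hn) ?_⟩
      rw [hmax]
      exact hr_le_Nr_HGraph (by omega) (by omega) (by omega)
    rcases max_choice (hr r n k 0) (hr r n k ((k - 1) / 2)) with h | h
    · exact key 0 (by omega) h
    · exact key _ (by omega) h
  · rintro _ ⟨G, hG, rfl⟩
    exact hG.Nr_le hr2 hn
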